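/- arXiv:1407.7623 — 2 statements merged into one kernel-verified Lean document; each statement's English description precedes it below -/
import Mathlib

section
/- Let (E, μ) be a probability space, T : E → E an ergodic measure-preserving transformation, and ω ↦ ν(ω) a measurable kernel assigning to each ω ∈ E a Borel probability measure on ℝ. Assume that for μ-a.e. ω, ∫ |x| ν(ω)(dx) < ∞; let μ̄(ω) = ∫ x ν(ω)(dx) and σ²(ω) = ∫ (x − μ̄(ω))² ν(ω)(dx), and assume 0 < ∫_E σ²(ω) μ(dω) < ∞. For ω ∈ E set μ_i = μ̄(T^iω), σ_i² = σ²(T^iω), a_n = Σ_{i=0}^{n−1} μ_i and b_n = (Σ_{i=0}^{n−1} σ_i²)^{1/2}. Then for μ-a.e. ω and every x ∈ ℝ, (ν(ω) ∗ ν(Tω) ∗ ⋯ ∗ ν(T^{n−1}ω))((−∞, b_n x + a_n]) → Φ(x) as n → ∞. -/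
open MeasureTheory Filter Topology Set
open scoped ENNReal NNReal

/-- running maxima of Birkhoff sums -/
noncomputable def bmax {E : Type*} (T : E → E) (f : E → ℝ) : ℕ → E → ℝ
  | 0 => fun _ => 0
  | n + 1 => fun ω => max 0 (f ω + bmax T f n (T ω))

lemma bmax_nonneg {E : Type*} (T : E → E) (f : E → ℝ) (n : ℕ) (ω : E) : 0 ≤ bmax T f n ω := by
  cases n <;> simp [bmax]

lemma bmax_le_succ {E : Type*} (T : E → E) (f : E → ℝ) (n : ℕ) :
    ∀ ω, bmax T f n ω ≤ bmax T f (n + 1) ω := by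
  induction n with
  | zero => intro ω; simp [bmax]
  | succ n ih =>
    intro ω
    have := ih (T ω)
    show max 0 (f ω + bmax T f n (T ω)) ≤ max 0 (f ω + bmax T f (n + 1) (T ω))
    gcongr

lemma sum_le_bmax {E : Type*} (T : E → E) (f : E → ℝ) (n : ℕ) :
    ∀ ω, ∑ i ∈ Finset.range n, f (T^[i] ω) ≤ bmax T f n ω := by
  induction n with
  | zero => intro ω; simp [bmax]
  | succ n ih =>
    intro ω
    rw [Finset.sum_range_succ']
    have := ih (T ω)
    simp only [Function.iterate_succ, Function.comp, Function.iterate_zero, id]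
    show _ ≤ max 0 (f ω + bmax T f n (T ω))
    refine le_trans ?_ (le_max_right _ _)
    linarith

lemma bmax_measurable {E : Type*} [MeasurableSpace E] (T : E → E) (hT : Measurable T)
    (f : E → ℝ) (hf : Measurable f) (n : ℕ) : Measurable (bmax T f n) := by
  induction n with
  | zero => exact measurable_const
  | succ n ih => exact measurable_const.max (hf.add (ih.comp hT))

lemma bmax_integrable {E : Type*} [MeasurableSpace E] {μ : Measure E} [IsProbabilityMeasure μ]
    (T : E → E) (hT : MeasurePreserving T μ μ)
    (f : E → ℝ) (hf : Integrable f μ) (n : ℕ) : Integrable (bmax T f n) μ := by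
  induction n with
  | zero => exact integrable_const _
  | succ n ih => exact (integrable_const (0:ℝ)).sup (hf.add (hT.integrable_comp_of_integrable ih))

lemma bmax_bddAbove {E : Type*} [MeasurableSpace E] {μ : Measure E} [IsProbabilityMeasure μ]
    (T : E → E) (hT : Ergodic T μ) (f : E → ℝ) (hfm : Measurable f) (hf : Integrable f μ)
    (hneg : ∫ ω, f ω ∂μ < 0) : ∀ᵐ ω ∂μ, BddAbove (range fun n => bmax T f n ω) := by
  have hTm := hT.toMeasurePreserving
  set A : Set E := {ω | BddAbove (range fun n => bmax T f n ω)} with hA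
  have hAm : MeasurableSet A :=
    measurableSet_bddAbove_range (fun n => bmax_measurable T hTm.measurable f hfm n)
  have hinv : T ⁻¹' A = A := by
    ext ω
    simp only [hA, mem_preimage, mem_ofPred_eq]
    constructor
    · rintro ⟨C, hC⟩
      refine ⟨max 0 (f ω + C), ?_⟩
      rintro _ ⟨n, rfl⟩
      refine (bmax_le_succ T f n ω).trans ?_
      show max 0 (f ω + bmax T f n (T ω)) ≤ _
      have := hC ⟨n, rfl⟩
      simp only at this
      gcongr
    · rintro ⟨C, hC⟩
      refine ⟨C - f ω, ?_⟩
      rintro _ ⟨n, rfl⟩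
      have := hC ⟨n + 1, rfl⟩
      have h2 : f ω + bmax T f n (T ω) ≤ bmax T f (n + 1) ω := le_max_right _ _
      simp only at this ⊢
      linarith
  rcases hT.toPreErgodic.ae_mem_or_ae_notMem hAm hinv with h | h
  · exact h
  exfalso
  have hint : ∀ n, 0 ≤ ∫ ω, (bmax T f (n + 1) ω - bmax T f n (T ω)) ∂μ := by
    intro n
    have i1 := bmax_integrable T hTm f hf (n + 1)
    have i0 := bmax_integrable T hTm f hf n
    have i2 : Integrable (fun ω => bmax T f n (T ω)) μ := hTm.integrable_comp_of_integrable i0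
    rw [integral_sub i1 i2]
    have : ∫ ω, bmax T f n (T ω) ∂μ = ∫ ω, bmax T f n ω ∂μ := by
      have h3 : AEStronglyMeasurable (bmax T f n) (μ.map T) := by
        rw [hTm.map_eq]; exact i0.aestronglyMeasurable
      have := integral_map hTm.measurable.aemeasurable h3
      rw [hTm.map_eq] at this
      exact this.symm
    rw [this, sub_nonneg]
    exact integral_mono i0 i1 (bmax_le_succ T f n)
  have hlim : Tendsto (fun n => ∫ ω, (bmax T f (n + 1) ω - bmax T f n (T ω)) ∂μ) atTop
      (𝓝 (∫ ω, f ω ∂μ)) := by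
    refine tendsto_integral_of_dominated_convergence (fun ω => |f ω|) ?_ hf.abs ?_ ?_
    · intro n
      exact ((bmax_measurable T hTm.measurable f hfm _).sub
        ((bmax_measurable T hTm.measurable f hfm _).comp hTm.measurable)).aestronglyMeasurable
    · intro n
      refine Eventually.of_forall fun ω => ?_
      have h1 := bmax_nonneg T f n (T ω)
      show |max 0 (f ω + bmax T f n (T ω)) - bmax T f n (T ω)| ≤ _
      rw [abs_le]
      have := neg_abs_le (f ω)
      have := le_abs_self (f ω)
      have := abs_nonneg (f ω)
      rcases max_cases 0 (f ω + bmax T f n (T ω)) with ⟨e, h⟩ | ⟨e, h⟩ <;> rw [e] <;>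
        constructor <;> linarith
    · filter_upwards [h] with ω hω
      have hω' : T ω ∉ A := by
        intro hh
        have : ω ∈ T ⁻¹' A := hh
        rw [hinv] at this
        exact hω this
      have hmono : Monotone fun n => bmax T f n (T ω) :=
        monotone_nat_of_le_succ fun n => bmax_le_succ T f n (T ω)
      have hinf : Tendsto (fun n => bmax T f n (T ω)) atTop atTop :=
        tendsto_atTop_atTop_of_monotone' hmono hω'
      refine tendsto_const_nhds.congr' ?_
      filter_upwards [hinf.eventually_ge_atTop (- f ω)] with n hn
      show f ω = max 0 (f ω + bmax T f n (T ω)) - bmax T f n (T ω)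
      rw [max_eq_right (by linarith)]
      ring
  have := ge_of_tendsto' hlim hint
  linarith

lemma birkhoff_upper {E : Type*} [MeasurableSpace E] {μ : Measure E} [IsProbabilityMeasure μ]
    (T : E → E) (hT : Ergodic T μ) (f : E → ℝ) (hfm : Measurable f) (hf : Integrable f μ) :
    ∀ᵐ ω ∂μ, ∀ ε > (0:ℝ), ∀ᶠ n : ℕ in atTop,
      (∑ i ∈ Finset.range n, f (T^[i] ω)) / n < ∫ ω, f ω ∂μ + ε := by
  set m := ∫ ω, f ω ∂μ with hm
  have key : ∀ k : ℕ, ∀ᵐ ω ∂μ, BddAbove (range fun n =>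
      bmax T (fun ω => f ω - (m + 1 / ((k:ℝ) + 1))) n ω) := by
    intro k
    apply bmax_bddAbove T hT _ (hfm.sub measurable_const) (hf.sub (integrable_const _))
    show ∫ ω, (f ω - (m + 1 / ((k:ℝ) + 1))) ∂μ < 0
    rw [integral_sub hf (integrable_const _)]
    simp only [integral_const, probReal_univ, one_smul]
    have : 0 < 1 / ((k:ℝ) + 1) := by positivity
    linarith
  filter_upwards [ae_all_iff.2 key] with ω hω ε hε
  obtain ⟨k, hk⟩ := exists_nat_one_div_lt (half_pos hε)
  obtain ⟨C, hC⟩ := hω k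
  have h0 : Tendsto (fun n : ℕ => C / (n:ℝ)) atTop (𝓝 0) :=
    tendsto_const_div_atTop_nhds_zero_nat C
  filter_upwards [h0.eventually_lt_const (half_pos hε), eventually_gt_atTop 0] with n hn hn0
  have h1 := (sum_le_bmax T (fun ω => f ω - (m + 1 / ((k:ℝ) + 1))) n ω).trans (hC ⟨n, rfl⟩)
  rw [Finset.sum_sub_distrib] at h1
  simp only [Finset.sum_const, Finset.card_range, nsmul_eq_mul] at h1
  have hn' : (0:ℝ) < n := by exact_mod_cast hn0
  rw [div_lt_iff₀ hn'] at hn ⊢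
  have : (n:ℝ) * (1 / ((k:ℝ) + 1)) ≤ n * (ε / 2) := by gcongr
  nlinarith

lemma birkhoff_ae {E : Type*} [MeasurableSpace E] {μ : Measure E} [IsProbabilityMeasure μ]
    (T : E → E) (hT : Ergodic T μ) (f : E → ℝ) (hfm : Measurable f) (hf : Integrable f μ) :
    ∀ᵐ ω ∂μ, Tendsto (fun n : ℕ => (∑ i ∈ Finset.range n, f (T^[i] ω)) / (n:ℝ)) atTop
      (𝓝 (∫ ω, f ω ∂μ)) := by
  filter_upwards [birkhoff_upper T hT f hfm hf,
    birkhoff_upper T hT (fun ω => - f ω) hfm.neg hf.neg] with ω h1 h2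
  rw [Metric.tendsto_nhds]
  intro ε hε
  filter_upwards [h1 ε hε, h2 ε hε] with n a b
  rw [integral_neg, Finset.sum_neg_distrib, neg_div] at b
  rw [Real.dist_eq, abs_lt]
  constructor <;> linarith

lemma exp_taylor_bound (y : ℝ) :
    ‖Complex.exp (y * Complex.I) - (1 + y * Complex.I - y ^ 2 / 2)‖ ≤ 4 * y ^ 2 ∧
    ‖Complex.exp (y * Complex.I) - (1 + y * Complex.I - y ^ 2 / 2)‖ ≤ 4 * |y| ^ 3 := by
  have hsq : y ^ 2 = |y| ^ 2 := (sq_abs y).symm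
  have h0 := abs_nonneg y
  rcases le_or_gt |y| 1 with h | h
  · have hb := Complex.exp_bound (x := y * Complex.I) (by simpa using h) (n := 3) (by norm_num)
    have he : ∑ m ∈ Finset.range 3, ((y:ℂ) * Complex.I) ^ m / (m.factorial : ℂ) =
        1 + y * Complex.I - y ^ 2 / 2 := by
      simp [Finset.sum_range_succ, mul_pow, Nat.factorial]
      ring
    rw [he] at hb
    have : ‖(y:ℂ) * Complex.I‖ = |y| := by simp
    rw [this] at hb
    norm_num [Nat.factorial] at hb
    have h3 : |y| ^ 3 ≤ |y| ^ 2 := pow_le_pow_of_le_one h0 h (by norm_num)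
    have h4 : 0 ≤ |y| ^ 3 := by positivity
    rw [hsq]
    constructor <;> linarith
  · have hb : ‖Complex.exp (y * Complex.I) - (1 + y * Complex.I - y ^ 2 / 2)‖ ≤
        1 + (1 + |y| + |y| ^ 2 / 2) := by
      refine (norm_sub_le _ _).trans ?_
      rw [Complex.norm_exp_ofReal_mul_I]
      gcongr
      refine (norm_sub_le _ _).trans ?_
      gcongr
      · refine (norm_add_le _ _).trans ?_
        simp
      · simp
    rw [hsq]
    have h3 : |y| ^ 2 ≤ |y| ^ 3 := pow_le_pow_right₀ h.le (by norm_num)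
    constructor <;> nlinarith

lemma exp_neg_bound (p q : ℝ) (hp : 0 ≤ p) (hq : 0 ≤ q) :
    |Real.exp (-(p + q)) - (1 - (p + q))| ≤ p ^ 2 + q := by
  have h1 := Real.add_one_le_exp (-(p + q))
  rw [abs_of_nonneg (by linarith)]
  have h2 : Real.exp (-(p+q)) ≤ Real.exp (-p) := Real.exp_le_exp.2 (by linarith)
  have h3 : Real.exp (-p) ≤ 1 - p + p ^ 2 := by
    rcases le_or_gt p 1 with h | h
    · have := Real.abs_exp_sub_one_sub_id_le (x := -p) (by rw [abs_neg, abs_of_nonneg hp]; exact h)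
      have := (abs_le.1 this).2
      nlinarith
    · have : Real.exp (-p) ≤ 1 := Real.exp_le_one_iff.2 (by linarith)
      nlinarith
  linarith

lemma charFun_bound (ρ : Measure ℝ) [IsProbabilityMeasure ρ] (hi : Integrable (fun x => x) ρ)
    (hi2 : Integrable (fun x : ℝ => x ^ 2) ρ) (h0 : ∫ x, x ∂ρ = 0) (u K : ℝ) (hK : 0 ≤ K)
    (v g : ℝ) (hv : v = ∫ x, x ^ 2 ∂ρ)
    (hg : g = ∫ x, ({x : ℝ | K < |x|}.indicator (fun x => x ^ 2)) x ∂ρ) :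
    ‖charFun ρ u - (Real.exp (-(u ^ 2 * v / 2)) : ℝ)‖ ≤
      4 * |u| ^ 3 * K * v + 5 * u ^ 2 * g + u ^ 4 * K ^ 2 * v := by
  have hms : MeasurableSet {x : ℝ | K < |x|} := measurableSet_lt measurable_const (by fun_prop)
  have hig : Integrable ({x : ℝ | K < |x|}.indicator (fun x => x ^ 2)) ρ := hi2.indicator hms
  have hg0 : 0 ≤ g := by
    rw [hg]; exact integral_nonneg fun x => indicator_nonneg (fun x _ => sq_nonneg x) x
  have hv0 : 0 ≤ v := by rw [hv]; exact integral_nonneg fun x => sq_nonneg x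
  have hgv : g ≤ v := by
    rw [hg, hv]
    exact integral_mono hig hi2 fun x => indicator_le_self' (fun x _ => sq_nonneg x) x
  have hvg : v - g ≤ K ^ 2 := by
    rw [hg, hv, ← integral_sub hi2 hig]
    have : ∫ x : ℝ, K ^ 2 ∂ρ = K ^ 2 := by simp
    rw [← this]
    refine integral_mono (hi2.sub hig) (integrable_const _) fun x => ?_
    simp only [indicator, mem_ofPred_eq]
    split_ifs with h
    · simp; positivity
    · simp only [sub_zero]
      rw [← sq_abs]
      push Not at h
      gcongr
  have A : ‖charFun ρ u - ((1 - u ^ 2 * v / 2 : ℝ) : ℂ)‖ ≤ 4 * |u| ^ 3 * K * v + 4 * u ^ 2 * g := by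
    have iexp : Integrable (fun x : ℝ => Complex.exp (((u * x : ℝ) : ℂ) * Complex.I)) ρ := by
      refine (integrable_const (1:ℝ)).mono' (by fun_prop) (Eventually.of_forall fun x => ?_)
      rw [Complex.norm_exp_ofReal_mul_I]
    have i1 : Integrable (fun x : ℝ => (((u * x : ℝ) : ℂ) * Complex.I)) ρ :=
      ((hi.const_mul u).ofReal).mul_const _
    have i2 : Integrable (fun x : ℝ => (((u * x : ℝ) : ℂ) ^ 2 / 2)) ρ := by
      have := ((hi2.const_mul (u ^ 2 / 2)).ofReal (𝕜 := ℂ))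
      refine this.congr (Eventually.of_forall fun x => ?_)
      simp; ring
    have i3 : Integrable (fun x : ℝ => (1:ℂ) + ((u * x : ℝ) : ℂ) * Complex.I) ρ :=
      (integrable_const _).add i1
    have i4 : Integrable (fun x : ℝ => (1:ℂ) + ((u * x : ℝ) : ℂ) * Complex.I
      - ((u * x : ℝ) : ℂ) ^ 2 / 2) ρ := i3.sub i2
    have e2 : ∫ x : ℝ, (((u * x : ℝ) : ℂ) ^ 2 / 2) ∂ρ = ((u ^ 2 * v / 2 : ℝ) : ℂ) := by
      have : (fun x : ℝ => (((u * x : ℝ) : ℂ) ^ 2 / 2)) =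
        fun x : ℝ => ((u ^ 2 / 2 * x ^ 2 : ℝ) : ℂ) := by
        ext x; push_cast; ring
      rw [this, integral_complex_ofReal, integral_const_mul, ← hv]
      congr 1; ring
    have e1 : ∫ x : ℝ, (((u * x : ℝ) : ℂ) * Complex.I) ∂ρ = 0 := by
      rw [integral_mul_const, integral_complex_ofReal, integral_const_mul, h0]
      simp
    have e : charFun ρ u - ((1 - u ^ 2 * v / 2 : ℝ) : ℂ) =
        ∫ x : ℝ, (Complex.exp (((u * x : ℝ) : ℂ) * Complex.I) -
          (1 + ((u * x : ℝ) : ℂ) * Complex.I - ((u * x : ℝ) : ℂ) ^ 2 / 2)) ∂ρ := by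
      rw [integral_sub iexp i4, integral_sub i3 i2, integral_add (integrable_const _) i1, e1, e2,
        charFun_apply_real]
      simp
    rw [e]
    have ib : Integrable (fun x : ℝ => 4 * |u| ^ 3 * K * x ^ 2 +
        4 * u ^ 2 * ({x : ℝ | K < |x|}.indicator (fun x => x ^ 2)) x) ρ :=
      (hi2.const_mul _).add (hig.const_mul _)
    refine (norm_integral_le_of_norm_le ib (Eventually.of_forall fun x => ?_)).trans (le_of_eq ?_)
    · obtain ⟨b1, b2⟩ := exp_taylor_bound (u * x)
      simp only [indicator, mem_ofPred_eq]
      split_ifs with h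
      · refine b1.trans ?_
        have : 0 ≤ 4 * |u| ^ 3 * K * x ^ 2 := by positivity
        nlinarith
      · refine b2.trans ?_
        push Not at h
        rw [abs_mul, mul_pow]
        have : |x| ^ 3 ≤ K * x ^ 2 := by
          rw [← sq_abs x]
          have : 0 ≤ |x| ^ 2 := by positivity
          nlinarith
        have h3 : 0 ≤ |u| ^ 3 := by positivity
        nlinarith
    · rw [integral_add (hi2.const_mul _) (hig.const_mul _), integral_const_mul, integral_const_mul,
        ← hv, ← hg]
  have B := exp_neg_bound (u ^ 2 * (v - g) / 2) (u ^ 2 * g / 2)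
    (by have : 0 ≤ v - g := by linarith
        positivity) (by positivity)
  have eB : u ^ 2 * (v - g) / 2 + u ^ 2 * g / 2 = u ^ 2 * v / 2 := by ring
  rw [eB] at B
  have C : (u ^ 2 * (v - g) / 2) ^ 2 ≤ u ^ 4 * K ^ 2 * v := by
    have : (u ^ 2 * (v - g) / 2) ^ 2 = u ^ 4 * ((v - g) * (v - g)) / 4 := by ring
    rw [this]
    have h1 : (v - g) * (v - g) ≤ K ^ 2 * v :=
      mul_le_mul hvg (by linarith) (by linarith) (by positivity)
    have h4 : 0 ≤ u ^ 4 := by positivity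
    have : 0 ≤ K ^ 2 * v := by positivity
    nlinarith
  have D : ‖((1 - u ^ 2 * v / 2 : ℝ) : ℂ) - (Real.exp (-(u ^ 2 * v / 2)) : ℝ)‖ ≤
      u ^ 4 * K ^ 2 * v + u ^ 2 * g / 2 := by
    rw [← Complex.ofReal_sub, Complex.norm_real, Real.norm_eq_abs, abs_sub_comm]
    linarith
  have := norm_sub_le_norm_sub_add_norm_sub (charFun ρ u) ((1 - u ^ 2 * v / 2 : ℝ) : ℂ)
    (Real.exp (-(u ^ 2 * v / 2)) : ℝ)
  have : 0 ≤ u ^ 2 * g := by positivity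
  linarith

lemma prod_sub_prod_bound (n : ℕ) (z w : ℕ → ℂ) (hz : ∀ i < n, ‖z i‖ ≤ 1) (hw : ∀ i < n, ‖w i‖ ≤ 1) :
    ‖∏ i ∈ Finset.range n, z i - ∏ i ∈ Finset.range n, w i‖ ≤
      ∑ i ∈ Finset.range n, ‖z i - w i‖ := by
  induction n with
  | zero => simp
  | succ n ih =>
    rw [Finset.prod_range_succ, Finset.prod_range_succ, Finset.sum_range_succ]
    have ih' := ih (fun i hi => hz i (by omega)) (fun i hi => hw i (by omega))
    set P := ∏ i ∈ Finset.range n, z i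
    set Q := ∏ i ∈ Finset.range n, w i with hQ
    have hQ1 : ‖Q‖ ≤ 1 := by
      rw [hQ, norm_prod]
      exact Finset.prod_le_one (fun i _ => norm_nonneg _)
        (fun i hi => hw i (by have := Finset.mem_range.1 hi; omega))
    have e : P * z n - Q * w n = (P - Q) * z n + Q * (z n - w n) := by ring
    rw [e]
    refine (norm_add_le _ _).trans ?_
    rw [norm_mul, norm_mul]
    have h1 := hz n (by omega)
    have := mul_le_mul_of_nonneg_left h1 (norm_nonneg (P - Q))
    have := mul_le_mul_of_nonneg_right hQ1 (norm_nonneg (z n - w n))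
    linarith

lemma charFun_normalized (n : ℕ) (ν : ℕ → Measure ℝ) [∀ i, IsProbabilityMeasure (ν i)]
    (m : ℕ → ℝ) (c t : ℝ) :
    charFun (((Measure.pi fun i : Fin n => ν i).map (fun f : Fin n → ℝ => ∑ i, f i)).map
      (fun y => c * (y + -(∑ i ∈ Finset.range n, m i)))) t =
      ∏ i ∈ Finset.range n, charFun ((ν i).map (fun y => y + - m i)) (c * t) := by
  have h1 : (fun y : ℝ => c * (y + -(∑ i ∈ Finset.range n, m i))) =
      (fun y => c * y) ∘ (fun y => y + -(∑ i ∈ Finset.range n, m i)) := rfl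
  rw [h1, ← Measure.map_map (by fun_prop) (by fun_prop), charFun_map_mul, charFun_map_add_const,
    ProbabilityTheory.charFun_map_sum_pi_eq_prod]
  simp_rw [charFun_map_add_const]
  rw [Finset.prod_mul_distrib, ← Complex.exp_sum, Finset.prod_apply,
    ← Fin.prod_univ_eq_prod_range (fun i => charFun (ν i) (c * t)) n]
  congr 2
  simp [Finset.sum_mul, Finset.mul_sum]

lemma lindeberg_charFun (ν : ℕ → Measure ℝ) [∀ i, IsProbabilityMeasure (ν i)]
    (m v : ℕ → ℝ) (g : ℕ → ℕ → ℝ)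
    (hi : ∀ i, Integrable (fun x => x) (ν i)) (hm : ∀ i, m i = ∫ x, x ∂(ν i))
    (hi2 : ∀ i, Integrable (fun x => (x - m i) ^ 2) (ν i))
    (hv : ∀ i, v i = ∫ x, (x - m i) ^ 2 ∂(ν i))
    (hg : ∀ K i, g K i = ∫ x, ({x : ℝ | (K:ℝ) < |x - m i|}.indicator (fun x => (x - m i) ^ 2)) x ∂(ν i))
    (V : ℝ) (hV0 : 0 < V)
    (hV : Tendsto (fun n : ℕ => (∑ i ∈ Finset.range n, v i) / (n:ℝ)) atTop (𝓝 V))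
    (G : ℕ → ℝ)
    (hG : ∀ K, Tendsto (fun n : ℕ => (∑ i ∈ Finset.range n, g K i) / (n:ℝ)) atTop (𝓝 (G K)))
    (hG0 : Tendsto G atTop (𝓝 0)) (t : ℝ) :
    Tendsto (fun n : ℕ => ∏ i ∈ Finset.range n, charFun ((ν i).map (fun y => y + - m i))
      ((Real.sqrt (∑ i ∈ Finset.range n, v i))⁻¹ * t)) atTop (𝓝 ((Real.exp (-(t ^ 2 / 2)) : ℝ) : ℂ)) := by
  set S : ℕ → ℝ := fun n => ∑ i ∈ Finset.range n, v i with hS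
  have hSinf : Tendsto S atTop atTop := by
    have h1 : Tendsto (fun n : ℕ => (S n / n) * n) atTop atTop :=
      Tendsto.pos_mul_atTop hV0 hV tendsto_natCast_atTop_atTop
    refine h1.congr' ?_
    filter_upwards [eventually_gt_atTop 0] with n hn
    have : (n:ℝ) ≠ 0 := by positivity
    field_simp
  have hsqinf : Tendsto (fun n => Real.sqrt (S n)) atTop atTop :=
    Real.tendsto_sqrt_atTop.comp hSinf
  have hρi : ∀ i, Integrable (fun x => x) ((ν i).map (fun y => y + - m i)) := by
    intro i
    rw [integrable_map_measure (by fun_prop) (by fun_prop)]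
    exact (hi i).add (integrable_const _)
  have hρi2 : ∀ i, Integrable (fun x : ℝ => x ^ 2) ((ν i).map (fun y => y + - m i)) := by
    intro i
    rw [integrable_map_measure (by fun_prop) (by fun_prop)]
    exact hi2 i
  have hρ0 : ∀ i, ∫ x, x ∂((ν i).map (fun y => y + - m i)) = 0 := by
    intro i
    rw [integral_map (by fun_prop) (by fun_prop), integral_add (hi i) (integrable_const _), ← hm]
    simp
  have hρv : ∀ i, v i = ∫ x, x ^ 2 ∂((ν i).map (fun y => y + - m i)) := by
    intro i
    rw [integral_map (by fun_prop) (by fun_prop), hv]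
    rfl
  have hρg : ∀ K i, g K i = ∫ x, ({x : ℝ | (K:ℝ) < |x|}.indicator (fun x => x ^ 2)) x
      ∂((ν i).map (fun y => y + - m i)) := by
    intro K i
    rw [integral_map (by fun_prop), hg]
    · rfl
    · have hms : MeasurableSet {x : ℝ | (K:ℝ) < |x|} :=
        measurableSet_lt measurable_const (by fun_prop)
      exact (Measurable.indicator (by fun_prop) hms).aestronglyMeasurable
  have hp : ∀ i, IsProbabilityMeasure ((ν i).map (fun y => y + - m i)) := fun i =>
    Measure.isProbabilityMeasure_map (by fun_prop)
  have main : ∀ K : ℕ, ∀ᶠ n in atTop,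
      ‖∏ i ∈ Finset.range n, charFun ((ν i).map (fun y => y + - m i))
        ((Real.sqrt (S n))⁻¹ * t) - ((Real.exp (-(t ^ 2 / 2)) : ℝ) : ℂ)‖ ≤
      4 * |t| ^ 3 * K * (Real.sqrt (S n))⁻¹ + 5 * t ^ 2 * (((∑ i ∈ Finset.range n, g K i) / n) /
        (S n / n)) + t ^ 4 * K ^ 2 * (S n)⁻¹ := by
    intro K
    filter_upwards [hSinf.eventually_gt_atTop 0, eventually_gt_atTop 0] with n hn hn0
    have hs : 0 < Real.sqrt (S n) := Real.sqrt_pos.2 hn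
    have hss : Real.sqrt (S n) ^ 2 = S n := Real.sq_sqrt hn.le
    set s := Real.sqrt (S n) with hsdef
    have hvn : ∀ i, 0 ≤ v i := fun i => by rw [hv]; exact integral_nonneg fun x => sq_nonneg _
    have e : ((Real.exp (-(t ^ 2 / 2)) : ℝ) : ℂ) = ∏ i ∈ Finset.range n,
        ((Real.exp (-((s⁻¹ * t) ^ 2 * v i / 2)) : ℝ) : ℂ) := by
      rw [← Complex.ofReal_prod, ← Real.exp_sum, Finset.sum_neg_distrib, ← Finset.sum_div,
        ← Finset.mul_sum]
      congr 4
      show t ^ 2 = (s⁻¹ * t) ^ 2 * S n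
      rw [← hss]
      field_simp
    rw [e]
    refine (prod_sub_prod_bound n _ _ (fun i _ => norm_charFun_le_one _) ?_).trans ?_
    · intro i _
      rw [Complex.norm_real, Real.norm_eq_abs, abs_of_pos (Real.exp_pos _), Real.exp_le_one_iff]
      have := hvn i
      have : 0 ≤ (s⁻¹ * t) ^ 2 * v i / 2 := by positivity
      linarith
    refine (Finset.sum_le_sum fun i _ => charFun_bound _ (hρi i) (hρi2 i) (hρ0 i) (s⁻¹ * t) K
      (Nat.cast_nonneg K) (v i) (g K i) (hρv i) (hρg K i)).trans (le_of_eq ?_)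
    rw [Finset.sum_add_distrib, Finset.sum_add_distrib, ← Finset.mul_sum, ← Finset.mul_sum,
      ← Finset.mul_sum]
    show 4 * |s⁻¹ * t| ^ 3 * K * S n + _ + (s⁻¹ * t) ^ 4 * K ^ 2 * S n = _
    rw [abs_mul, abs_of_pos (inv_pos.2 hs), ← hss]
    have : (n:ℝ) ≠ 0 := by positivity
    field_simp
  rw [tendsto_iff_norm_sub_tendsto_zero, Metric.tendsto_nhds]
  intro ε hε
  have hK : Tendsto (fun K => 5 * t ^ 2 * (G K / V)) atTop (𝓝 0) := by
    have := (hG0.div_const V).const_mul (5 * t ^ 2)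
    simpa using this
  obtain ⟨K, hK⟩ := (hK.eventually_lt_const hε).exists
  have lim : Tendsto (fun n : ℕ => 4 * |t| ^ 3 * K * (Real.sqrt (S n))⁻¹ +
      5 * t ^ 2 * (((∑ i ∈ Finset.range n, g K i) / n) /
        (S n / n)) + t ^ 4 * K ^ 2 * (S n)⁻¹) atTop (𝓝 (4 * |t| ^ 3 * K * 0 +
        5 * t ^ 2 * (G K / V) + t ^ 4 * K ^ 2 * 0)) := by
    refine Tendsto.add (Tendsto.add ?_ ?_) ?_
    · exact (tendsto_inv_atTop_zero.comp hsqinf).const_mul _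
    · exact ((hG K).div hV hV0.ne').const_mul _
    · exact (tendsto_inv_atTop_zero.comp hSinf).const_mul _
  have h2 := lim.eventually_lt_const (show _ < ε by simpa using hK)
  filter_upwards [h2, main K] with n a b
  rw [Real.dist_eq, sub_zero, abs_of_nonneg (norm_nonneg _)]
  exact b.trans_lt a

lemma gaussian_Iic (x : ℝ) : (ProbabilityTheory.gaussianReal 0 1 (Iic x)).toReal =
    (Real.sqrt (2 * Real.pi))⁻¹ * ∫ t in Set.Iic x, Real.exp (-t ^ 2 / 2) := by
  rw [ProbabilityTheory.gaussianReal_apply_eq_integral _ one_ne_zero, ENNReal.toReal_ofReal]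
  · simp [ProbabilityTheory.gaussianPDFReal, integral_const_mul]
  · exact integral_nonneg fun t => ProbabilityTheory.gaussianPDFReal_nonneg _ _ _

lemma lindeberg_clt (ν : ℕ → Measure ℝ) [∀ i, IsProbabilityMeasure (ν i)]
    (m v : ℕ → ℝ) (g : ℕ → ℕ → ℝ)
    (hi : ∀ i, Integrable (fun x => x) (ν i)) (hm : ∀ i, m i = ∫ x, x ∂(ν i))
    (hi2 : ∀ i, Integrable (fun x => (x - m i) ^ 2) (ν i))
    (hv : ∀ i, v i = ∫ x, (x - m i) ^ 2 ∂(ν i))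
    (hg : ∀ K i, g K i = ∫ x, ({x : ℝ | (K:ℝ) < |x - m i|}.indicator (fun x => (x - m i) ^ 2)) x ∂(ν i))
    (V : ℝ) (hV0 : 0 < V)
    (hV : Tendsto (fun n : ℕ => (∑ i ∈ Finset.range n, v i) / (n:ℝ)) atTop (𝓝 V))
    (G : ℕ → ℝ)
    (hG : ∀ K, Tendsto (fun n : ℕ => (∑ i ∈ Finset.range n, g K i) / (n:ℝ)) atTop (𝓝 (G K)))
    (hG0 : Tendsto G atTop (𝓝 0)) (x : ℝ) :
    Tendsto (fun n : ℕ =>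
          ((Measure.map (fun f : Fin n → ℝ => ∑ i, f i)
              (Measure.pi fun i : Fin n => ν i))
            (Set.Iic (Real.sqrt (∑ i ∈ Finset.range n, v i) * x + ∑ i ∈ Finset.range n, m i))).toReal)
        atTop
        (nhds ((Real.sqrt (2 * Real.pi))⁻¹ * ∫ t in Set.Iic x, Real.exp (-t ^ 2 / 2))) := by
  rw [← gaussian_Iic]
  have hp1 : ∀ n : ℕ, IsProbabilityMeasure ((Measure.pi fun i : Fin n => ν i).map
      (fun f : Fin n → ℝ => ∑ i, f i)) := fun n =>
    Measure.isProbabilityMeasure_map (by fun_prop)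
  let P : ℕ → ProbabilityMeasure ℝ := fun n =>
    ⟨((Measure.pi fun i : Fin n => ν i).map (fun f : Fin n → ℝ => ∑ i, f i)).map
      (fun y => (Real.sqrt (∑ i ∈ Finset.range n, v i))⁻¹ * (y + -(∑ i ∈ Finset.range n, m i))),
      Measure.isProbabilityMeasure_map (by fun_prop)⟩
  let Γ : ProbabilityMeasure ℝ := ⟨ProbabilityTheory.gaussianReal 0 1, inferInstance⟩
  have hconv : Tendsto P atTop (𝓝 Γ) := by
    rw [ProbabilityMeasure.tendsto_iff_tendsto_charFun]
    intro t
    have h := lindeberg_charFun ν m v g hi hm hi2 hv hg V hV0 hV G hG hG0 t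
    have e : charFun (Γ : Measure ℝ) t = ((Real.exp (-(t ^ 2 / 2)) : ℝ) : ℂ) := by
      show charFun (ProbabilityTheory.gaussianReal 0 1) t = _
      rw [ProbabilityTheory.charFun_gaussianReal]
      push_cast
      congr 1
      simp
    rw [e]
    refine h.congr fun n => ?_
    exact (charFun_normalized n ν m _ t).symm
  have hfr := ProbabilityMeasure.tendsto_measure_of_null_frontier_of_tendsto' hconv
    (E := Iic x) (by
      show ProbabilityTheory.gaussianReal 0 1 (frontier (Iic x)) = 0
      have := ProbabilityTheory.nullSingletonClass_gaussianReal (μ := 0) (v := 1) one_ne_zero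
      rw [frontier_Iic]
      exact measure_singleton _)
  have hfr2 := (ENNReal.tendsto_toReal (measure_ne_top _ _)).comp hfr
  refine Tendsto.congr' ?_ hfr2
  have hpos : ∀ᶠ n : ℕ in atTop, 0 < (∑ i ∈ Finset.range n, v i) / (n:ℝ) :=
    hV.eventually_const_lt hV0
  filter_upwards [hpos, eventually_gt_atTop 0] with n hn hn0
  have hS : 0 < ∑ i ∈ Finset.range n, v i := by
    have : (0:ℝ) < n := by positivity
    exact (div_pos_iff_of_pos_right this).1 hn
  have hs := Real.sqrt_pos.2 hS
  show ((((Measure.pi fun i : Fin n => ν i).map (fun f : Fin n → ℝ => ∑ i, f i)).map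
      (fun y => (Real.sqrt (∑ i ∈ Finset.range n, v i))⁻¹ *
        (y + -(∑ i ∈ Finset.range n, m i)))) (Iic x)).toReal = _
  rw [Measure.map_apply (by fun_prop) measurableSet_Iic]
  congr 2
  ext y
  simp only [mem_preimage, mem_Iic]
  rw [inv_mul_le_iff₀ hs]
  constructor <;> intro h <;> linarith

/-- **Central limit theorem for the normalized quenched means**
`E_ξ Z_n(·)/E_ξ Z_n(ℝ)` of a branching random walk in a stationary ergodic random
environment (Theorem 9.1): the convolution `ν(ω) ∗ ν(Tω) ∗ ⋯ ∗ ν(T^{n−1}ω)` of the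
normalized intensity measures, evaluated at `(−∞, b_n x + a_n]`, converges a.s. to the
standard normal distribution function `Φ(x)`. -/
theorem quenched_mean_CLT
    {E : Type*} [MeasurableSpace E] (μ : Measure E) [IsProbabilityMeasure μ]
    (T : E → E) (hT : Ergodic T μ)
    (ν : E → Measure ℝ) (hνmeas : Measurable ν)
    [hνprob : ∀ ω, IsProbabilityMeasure (ν ω)]
    (hL1 : ∀ᵐ ω ∂μ, Integrable (fun x => |x|) (ν ω))
    (μbar : E → ℝ) (hμbar : ∀ ω, μbar ω = ∫ x, x ∂(ν ω))
    (σ2 : E → ℝ≥0∞)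
    (hσ2 : ∀ ω, σ2 ω = ∫⁻ x, ENNReal.ofReal ((x - μbar ω) ^ 2) ∂(ν ω))
    (hσ2pos : 0 < ∫⁻ ω, σ2 ω ∂μ) (hσ2fin : (∫⁻ ω, σ2 ω ∂μ) < ⊤)
    (a b : ℕ → E → ℝ)
    (ha : ∀ n ω, a n ω = ∑ i ∈ Finset.range n, μbar (T^[i] ω))
    (hb : ∀ n ω, b n ω = Real.sqrt (∑ i ∈ Finset.range n, (σ2 (T^[i] ω)).toReal)) :
    ∀ᵐ ω ∂μ, ∀ x : ℝ,
      Tendsto (fun n : ℕ =>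
          ((Measure.map (fun f : Fin n → ℝ => ∑ i, f i)
              (Measure.pi fun i : Fin n => ν (T^[(i : ℕ)] ω)))
            (Set.Iic (b n ω * x + a n ω))).toReal)
        atTop
        (nhds ((Real.sqrt (2 * Real.pi))⁻¹ * ∫ t in Set.Iic x, Real.exp (-t ^ 2 / 2))) := by
  classical
  let κ : ProbabilityTheory.Kernel E ℝ := ⟨ν, hνmeas⟩
  have hκ : ∀ ω, κ ω = ν ω := fun _ => rfl
  have : ProbabilityTheory.IsMarkovKernel κ := ⟨fun ω => hνprob ω⟩
  have hmm : Measurable μbar := by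
    have : μbar = fun ω => ∫ x, x ∂(κ ω) := funext hμbar
    rw [this]
    exact (StronglyMeasurable.integral_kernel_prod_right' (κ := κ) (f := fun p : E × ℝ => p.2)
      measurable_snd.stronglyMeasurable).measurable
  let Q : E × ℝ → ℝ≥0∞ := fun p => ENNReal.ofReal ((p.2 - μbar p.1) ^ 2)
  have hQ : Measurable Q :=
    ENNReal.measurable_ofReal.comp ((measurable_snd.sub (hmm.comp measurable_fst)).pow_const 2)
  let B : ℕ → Set (E × ℝ) := fun K => {p | (K:ℝ) < |p.2 - μbar p.1|}
  have hB : ∀ K, MeasurableSet (B K) := fun K =>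
    measurableSet_lt measurable_const ((measurable_snd.sub (hmm.comp measurable_fst)).norm)
  have hF : ∀ K, Measurable ((B K).indicator Q) := fun K => hQ.indicator (hB K)
  have hσ2eq : σ2 = fun ω => ∫⁻ x, Q (ω, x) ∂(κ ω) := funext hσ2
  have hσ2m : Measurable σ2 := by
    rw [hσ2eq]; exact hQ.lintegral_kernel_prod_right'
  let g : ℕ → E → ℝ≥0∞ := fun K ω => ∫⁻ x, (B K).indicator Q (ω, x) ∂(κ ω)
  have hgm : ∀ K, Measurable (g K) := fun K => (hF K).lintegral_kernel_prod_right'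
  have hgle : ∀ K ω, g K ω ≤ σ2 ω := by
    intro K ω
    rw [hσ2eq]
    exact lintegral_mono fun x => indicator_le_self _ _ _
  have hgfin : ∀ K, ∫⁻ ω, g K ω ∂μ < ⊤ := fun K => (lintegral_mono (hgle K)).trans_lt hσ2fin
  have hσae : ∀ᵐ ω ∂μ, σ2 ω < ⊤ := ae_lt_top hσ2m hσ2fin.ne
  have hTm := hT.toMeasurePreserving
  have orbit : ∀ {p : E → Prop}, (∀ᵐ ω ∂μ, p ω) → ∀ᵐ ω ∂μ, ∀ i : ℕ, p (T^[i] ω) := by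
    intro p hp
    exact ae_all_iff.2 fun i => (hTm.iterate i).quasiMeasurePreserving.ae hp
  have hG0 : Tendsto (fun K => ∫ ω, (g K ω).toReal ∂μ) atTop (𝓝 0) := by
    have e : ∀ K, ∫ ω, (g K ω).toReal ∂μ = (∫⁻ p, (B K).indicator Q p ∂(μ.compProd κ)).toReal := by
      intro K
      rw [integral_toReal (hgm K).aemeasurable (ae_lt_top (hgm K) (hgfin K).ne),
        Measure.lintegral_compProd (hF K)]
    simp_rw [e]
    have h : Tendsto (fun K => ∫⁻ p, (B K).indicator Q p ∂(μ.compProd κ)) atTop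
        (𝓝 (∫⁻ p, 0 ∂(μ.compProd κ))) := by
      refine tendsto_lintegral_of_dominated_convergence Q (fun K => hF K) ?_ ?_ ?_
      · exact fun K => Eventually.of_forall fun p => indicator_le_self _ _ _
      · rw [Measure.lintegral_compProd hQ]
        have : ∫⁻ ω, σ2 ω ∂μ ≠ ⊤ := hσ2fin.ne
        rwa [hσ2eq] at this
      · refine Eventually.of_forall fun p => ?_
        refine tendsto_const_nhds.congr' ?_
        obtain ⟨N, hN⟩ := exists_nat_ge |p.2 - μbar p.1|
        filter_upwards [eventually_ge_atTop N] with K hK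
        rw [indicator_of_notMem]
        intro hh
        have h1 : (K:ℝ) < |p.2 - μbar p.1| := hh
        have h2 : (N:ℝ) ≤ K := by exact_mod_cast hK
        linarith
    rw [lintegral_zero] at h
    have h5 := (ENNReal.tendsto_toReal ENNReal.zero_ne_top).comp h
    rw [ENNReal.toReal_zero] at h5
    exact h5
  have bσ := birkhoff_ae T hT (fun ω => (σ2 ω).toReal) hσ2m.ennreal_toReal
    (integrable_toReal_of_lintegral_ne_top hσ2m.aemeasurable hσ2fin.ne)
  have bg := fun K => birkhoff_ae T hT (fun ω => (g K ω).toReal) (hgm K).ennreal_toReal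
    (integrable_toReal_of_lintegral_ne_top (hgm K).aemeasurable (hgfin K).ne)
  have hV0 : 0 < ∫ ω, (σ2 ω).toReal ∂μ := by
    rw [integral_toReal hσ2m.aemeasurable hσae]
    exact ENNReal.toReal_pos hσ2pos.ne' hσ2fin.ne
  filter_upwards [bσ, ae_all_iff.2 bg, orbit hσae, orbit hL1] with ω h1 h2 h3 h4 x
  simp_rw [ha, hb]
  have hmeas : ∀ i : ℕ, Measurable fun x : ℝ => (x - μbar (T^[i] ω)) ^ 2 := fun i => by fun_prop
  refine lindeberg_clt (fun i => ν (T^[i] ω)) (fun i => μbar (T^[i] ω))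
    (fun i => (σ2 (T^[i] ω)).toReal) (fun K i => (g K (T^[i] ω)).toReal) ?_ (fun i => hμbar _)
    ?_ ?_ ?_ _ hV0 h1 _ h2 hG0 x
  · intro i
    have := h4 i
    exact (integrable_norm_iff (f := fun x : ℝ => x) (by fun_prop)).1 this
  · intro i
    refine ⟨(hmeas i).aestronglyMeasurable, ?_⟩
    rw [hasFiniteIntegral_iff_ofReal (Eventually.of_forall fun x => sq_nonneg _), ← hσ2]
    exact h3 i
  · intro i
    rw [integral_eq_lintegral_of_nonneg_ae (Eventually.of_forall fun x => sq_nonneg _)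
      (hmeas i).aestronglyMeasurable, ← hσ2]
  · intro K i
    have hms : MeasurableSet {x : ℝ | (K:ℝ) < |x - μbar (T^[i] ω)|} :=
      measurableSet_lt measurable_const (by fun_prop)
    rw [integral_eq_lintegral_of_nonneg_ae
      (Eventually.of_forall fun x => indicator_nonneg (fun x _ => sq_nonneg _) x)
      ((hmeas i).indicator hms).aestronglyMeasurable]
    congr 1
    refine lintegral_congr fun x => ?_
    by_cases hx : (K:ℝ) < |x - μbar (T^[i] ω)|
    · rw [indicator_of_mem (show (T^[i] ω, x) ∈ B K from hx),
        indicator_of_mem (show x ∈ {x : ℝ | (K:ℝ) < |x - μbar (T^[i] ω)|} from hx)]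
    · rw [indicator_of_notMem (show (T^[i] ω, x) ∉ B K from hx),
        indicator_of_notMem (show x ∉ {x : ℝ | (K:ℝ) < |x - μbar (T^[i] ω)|} from hx)]
      simp
end

section
/- Let (E, μ) be a probability space, T : E → E an ergodic measure-preserving transformation, and c : E → ℝ measurable with 0 < c(ω) < 1 for μ-a.e. ω. Let p ≥ 0 and let (k_n) be natural numbers with k_n < n and k_n/n → 0. Then for μ-a.e. ω, n^p ∏_{i=k_n}^{n−1} c(T^iω) → 0 as n → ∞. -/
open MeasureTheory Filter Topology

/-- truncated maximal Birkhoff sums -/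
noncomputable def maxBS {E : Type*} (T : E → E) (g : E → ℝ) : ℕ → E → ℝ
  | 0 => fun _ => 0
  | n + 1 => fun x => max 0 (g x + maxBS T g n (T x))

lemma maxBS_nonneg {E : Type*} (T : E → E) (g : E → ℝ) (n : ℕ) (x : E) : 0 ≤ maxBS T g n x := by
  cases n with
  | zero => simp [maxBS]
  | succ n => simp [maxBS]

lemma maxBS_mono {E : Type*} (T : E → E) (g : E → ℝ) (n : ℕ) :
    ∀ x : E, maxBS T g n x ≤ maxBS T g (n + 1) x := by
  induction n with
  | zero => intro x; exact maxBS_nonneg T g 1 x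
  | succ n ih =>
    intro x
    have := ih (T x)
    show max 0 (g x + maxBS T g n (T x)) ≤ max 0 (g x + maxBS T g (n + 1) (T x))
    gcongr

lemma sum_le_maxBS {E : Type*} (T : E → E) (g : E → ℝ) (n : ℕ) :
    ∀ x : E, ∑ i ∈ Finset.range n, g (T^[i] x) ≤ maxBS T g n x := by
  induction n with
  | zero => intro x; simp [maxBS]
  | succ n ih =>
    intro x
    rw [Finset.sum_range_succ']
    have := ih (T x)
    simp only [Function.iterate_succ, Function.comp, Function.iterate_zero, id]
    exact le_max_of_le_right (by linarith)

lemma maxBS_meas {E : Type*} [MeasurableSpace E] (T : E → E) (hT : Measurable T) (g : E → ℝ)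
    (hg : Measurable g) (n : ℕ) : Measurable (maxBS T g n) := by
  induction n with
  | zero => exact measurable_const
  | succ n ih => exact measurable_const.max (hg.add (ih.comp hT))

lemma maxBS_int {E : Type*} [MeasurableSpace E] (μ : Measure E) [IsProbabilityMeasure μ]
    (T : E → E) (hT : MeasurePreserving T μ μ) (g : E → ℝ)
    (hg : Integrable g μ) (n : ℕ) : Integrable (maxBS T g n) μ := by
  induction n with
  | zero => exact integrable_zero _ _ _
  | succ n ih =>
    exact (integrable_zero E ℝ μ).sup (hg.add (hT.integrable_comp_of_integrable ih))

lemma ergodic_bdd {E : Type*} [MeasurableSpace E] (μ : Measure E) [IsProbabilityMeasure μ]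
    (T : E → E) (hT : Ergodic T μ) (g : E → ℝ) (hgm : Measurable g)
    (hg : Integrable g μ) (hneg : ∫ x, g x ∂μ < 0) :
    ∀ᵐ x ∂μ, ∃ C : ℝ, ∀ n : ℕ, ∑ i ∈ Finset.range n, g (T^[i] x) ≤ C := by
  set B : Set E := {x | ∀ N : ℕ, ∃ n : ℕ, (N : ℝ) < maxBS T g n x} with hB
  have hBm : MeasurableSet B := by
    have : B = ⋂ N : ℕ, ⋃ n : ℕ, {x | (N : ℝ) < maxBS T g n x} := by
      ext x; simp [hB]
    rw [this]
    exact MeasurableSet.iInter fun N => MeasurableSet.iUnion fun n =>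
      measurableSet_lt measurable_const (maxBS_meas T hT.measurable g hgm n)
  have hBinv : T ⁻¹' B = B := by
    ext x
    constructor
    · intro h N
      obtain ⟨K, hK⟩ := exists_nat_gt ((N : ℝ) - g x)
      obtain ⟨n, hn⟩ := h K
      exact ⟨n + 1, lt_max_of_lt_right (by linarith)⟩
    · intro h N
      obtain ⟨K, hK⟩ := exists_nat_gt ((N : ℝ) + g x)
      obtain ⟨n, hn⟩ := h K
      have hK0 : (0 : ℝ) ≤ K := Nat.cast_nonneg K
      cases n with
      | zero => simp only [maxBS] at hn; linarith
      | succ n =>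
        refine ⟨n, ?_⟩
        rcases lt_max_iff.1 hn with h' | h'
        · linarith
        · linarith
  rcases hT.toPreErgodic.ae_mem_or_ae_notMem hBm hBinv with h | h
  · exfalso
    have hlim : Tendsto (fun n => ∫ x, (maxBS T g (n + 1) x - maxBS T g n (T x)) ∂μ) atTop
        (𝓝 (∫ x, g x ∂μ)) := by
      refine tendsto_integral_of_dominated_convergence (fun x => |g x|) ?_ hg.abs ?_ ?_
      · intro n
        exact ((maxBS_meas T hT.measurable g hgm (n+1)).sub
          ((maxBS_meas T hT.measurable g hgm n).comp hT.measurable)).aestronglyMeasurable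
      · intro n
        refine Eventually.of_forall fun x => ?_
        have h0 := maxBS_nonneg T g n (T x)
        simp only [maxBS, Real.norm_eq_abs]
        rcases max_cases 0 (g x + maxBS T g n (T x)) with ⟨h1, h2⟩ | ⟨h1, h2⟩
        · rw [h1, abs_le]
          constructor
          · linarith [neg_abs_le (g x)]
          · linarith [abs_nonneg (g x)]
        · rw [h1]; simp
      · filter_upwards [h] with x hx
        have hx' : T x ∈ B := by rw [← hBinv] at hx; exact hx
        obtain ⟨K, hK⟩ := exists_nat_gt (-g x)
        obtain ⟨n0, hn0⟩ := hx' K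
        refine tendsto_const_nhds.congr' ?_
        filter_upwards [eventually_ge_atTop n0] with n hn
        have hm : maxBS T g n0 (T x) ≤ maxBS T g n (T x) :=
          monotone_nat_of_le_succ (f := fun n => maxBS T g n (T x))
            (fun n => maxBS_mono T g n (T x)) hn
        simp only [maxBS]
        rw [max_eq_right (by linarith)]
        ring
    refine absurd (ge_of_tendsto' hlim (fun n => ?_)) (not_le.2 hneg)
    have hi := maxBS_int μ T hT.toMeasurePreserving g hg
    have hc' : Integrable (fun x => maxBS T g n (T x)) μ :=
      hT.toMeasurePreserving.integrable_comp_of_integrable (hi n)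
    rw [integral_sub (hi (n+1)) hc']
    have e : ∫ x, maxBS T g n (T x) ∂μ = ∫ x, maxBS T g n x ∂μ := by
      conv_rhs => rw [← hT.toMeasurePreserving.map_eq]
      rw [integral_map hT.measurable.aemeasurable
        (maxBS_meas T hT.measurable g hgm n).aestronglyMeasurable]
    rw [e, sub_nonneg]
    exact integral_mono (hi n) (hi (n+1)) (maxBS_mono T g n)
  · filter_upwards [h] with x hx
    simp only [hB, Set.mem_ofPred_eq, not_forall, not_exists, not_lt] at hx
    obtain ⟨N, hN⟩ := hx
    exact ⟨N, fun n => (sum_le_maxBS T g n x).trans (hN n)⟩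

/-- **Almost sure decay of ergodic products** (used in the proofs of Lemma 11.2 and
Theorem 8.1): if `0 < c(ω) < 1` a.e. for an ergodic system `(E, μ, T)`, `p ≥ 0` and
`k_n < n` with `k_n/n → 0`, then `n^p ∏_{i=k_n}^{n−1} c(T^iω) → 0` almost surely. -/
theorem ergodic_product_decay
    {E : Type*} [MeasurableSpace E] (μ : Measure E) [IsProbabilityMeasure μ]
    (T : E → E) (hT : Ergodic T μ)
    (c : E → ℝ) (hcmeas : Measurable c)
    (hc : ∀ᵐ ω ∂μ, 0 < c ω ∧ c ω < 1)
    (p : ℝ) (hp : 0 ≤ p)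
    (k : ℕ → ℕ) (hk : ∀ n : ℕ, 1 ≤ n → k n < n)
    (hk0 : Tendsto (fun n : ℕ => (k n : ℝ) / n) atTop (nhds 0)) :
    ∀ᵐ ω ∂μ, Tendsto
      (fun n : ℕ => (n : ℝ) ^ p * ∏ i ∈ Finset.Ico (k n) n, c (T^[i] ω))
      atTop (nhds 0) := by
  have hci : Integrable c μ := by
    refine Integrable.of_bound hcmeas.aestronglyMeasurable 1 ?_
    filter_upwards [hc] with x hx
    rw [Real.norm_eq_abs, abs_le]; constructor <;> linarith [hx.1, hx.2]
  have hfi : Integrable (fun x => 1 - c x) μ := (integrable_const 1).sub hci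
  have hpos : 0 < ∫ x, (1 - c x) ∂μ := by
    rw [integral_pos_iff_support_of_nonneg_ae _ hfi]
    · have : μ (Function.support fun x => 1 - c x) = μ Set.univ := by
        apply measure_congr
        rw [eventuallyEq_univ]
        filter_upwards [hc] with x hx
        simp only [Function.mem_support]
        exact (sub_pos.2 hx.2).ne'
      rw [this]; simp
    · filter_upwards [hc] with x hx
      exact (sub_pos.2 hx.2).le
  obtain ⟨ε, hε0, hε⟩ := exists_between hpos
  have hb := ergodic_bdd μ T hT (fun x => ε - (1 - c x))
    (measurable_const.sub (measurable_const.sub hcmeas)) ((integrable_const ε).sub hfi) (by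
      rw [integral_sub (integrable_const ε) hfi]; simp; simpa using hε)
  have hall : ∀ᵐ ω ∂μ, ∀ i : ℕ, 0 < c (T^[i] ω) ∧ c (T^[i] ω) < 1 := by
    rw [ae_all_iff]
    intro i
    exact (hT.toMeasurePreserving.iterate i).quasiMeasurePreserving.ae hc
  filter_upwards [hb, hall] with ω ⟨C, hC⟩ hω
  have hlim : Tendsto (fun n : ℕ => Real.exp C * ((n : ℝ) ^ p * Real.exp (-(ε / 2) * n))) atTop
      (𝓝 0) := by
    have := ((tendsto_rpow_mul_exp_neg_mul_atTop_nhds_zero p (ε / 2) (by positivity)).comp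
      tendsto_natCast_atTop_atTop).const_mul (Real.exp C)
    simpa using this
  refine squeeze_zero' (Eventually.of_forall fun n => ?_) ?_ hlim
  · exact mul_nonneg (Real.rpow_nonneg (Nat.cast_nonneg n) p)
      (Finset.prod_nonneg fun i _ => (hω i).1.le)
  · filter_upwards [hk0.eventually (gt_mem_nhds (half_pos hε0)), eventually_ge_atTop 1]
      with n hn hn1
    have hnpos : (0 : ℝ) < n := by exact_mod_cast hn1
    rw [div_lt_iff₀ hnpos] at hn
    have h1 : ∏ i ∈ Finset.Ico (k n) n, c (T^[i] ω)
        ≤ Real.exp (∑ i ∈ Finset.Ico (k n) n, (c (T^[i] ω) - 1)) := by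
      rw [Real.exp_sum]
      refine Finset.prod_le_prod (fun i _ => (hω i).1.le) fun i _ => ?_
      linarith [Real.add_one_le_exp (c (T^[i] ω) - 1)]
    have h2 := Finset.sum_range_add_sum_Ico (fun i => c (T^[i] ω) - 1) (hk n hn1).le
    have h3 : -(k n : ℝ) ≤ ∑ i ∈ Finset.range (k n), (c (T^[i] ω) - 1) := by
      have := Finset.card_nsmul_le_sum (Finset.range (k n)) (fun i => c (T^[i] ω) - 1) (-1)
        (fun i _ => by linarith [(hω i).1])
      simpa using this
    have h4 : ∑ i ∈ Finset.range n, (ε - (1 - c (T^[i] ω)))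
        = n * ε + ∑ i ∈ Finset.range n, (c (T^[i] ω) - 1) := by
      rw [← nsmul_eq_mul, ← Finset.card_range n, ← Finset.sum_const, Finset.card_range,
        ← Finset.sum_add_distrib]
      exact Finset.sum_congr rfl fun i _ => by ring
    have h5 := hC n
    rw [h4] at h5
    have h6 : ∑ i ∈ Finset.Ico (k n) n, (c (T^[i] ω) - 1) ≤ C + -(ε / 2) * n := by linarith
    calc (n : ℝ) ^ p * ∏ i ∈ Finset.Ico (k n) n, c (T^[i] ω)
        ≤ (n : ℝ) ^ p * Real.exp (C + -(ε / 2) * n) := by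
          gcongr
          exact h1.trans (Real.exp_le_exp.2 h6)
      _ = _ := by rw [Real.exp_add]; ring
end
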